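/- For every real number x, 0 < λ(x)·(x + λ(x)) < 1; equivalently, 0 < φ(x)·(x·Φ(x) + φ(x)) < Φ(x)² for all x ∈ ℝ. -/

import Mathlib

open MeasureTheory ProbabilityTheory Real

/-- The standard normal density φ(x) = (2π)^{-1/2} exp(-x²/2). -/
noncomputable def stdNormalPDF (x : ℝ) : ℝ :=
  (Real.sqrt (2 * Real.pi))⁻¹ * Real.exp (-x ^ 2 / 2)

/-- The standard normal distribution function Φ(x) = ∫_{-∞}^x φ(t) dt. -/
noncomputable def stdNormalCDF (x : ℝ) : ℝ :=
  ∫ t in Set.Iic x, stdNormalPDF t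

/-- The inverse Mills ratio λ(x) = φ(x)/Φ(x). -/
noncomputable def invMills (x : ℝ) : ℝ :=
  stdNormalPDF x / stdNormalCDF x

theorem stdNormalPDF_pos (x : ℝ) : 0 < stdNormalPDF x := by
  unfold stdNormalPDF
  positivity

theorem hasDerivAt_stdNormalPDF (x : ℝ) :
    HasDerivAt stdNormalPDF (-(x * stdNormalPDF x)) x := by
  have h : HasDerivAt (fun t : ℝ => -t ^ 2 / 2) (-x) x :=
    ((hasDerivAt_pow 2 x).fun_neg.div_const 2).congr_deriv (by norm_num; ring)
  refine (h.exp.const_mul (Real.sqrt (2 * Real.pi))⁻¹).congr_deriv ?_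
  unfold stdNormalPDF
  ring

theorem integrable_pow_mul_stdNormalPDF (n : ℕ) :
    Integrable fun t : ℝ => t ^ n * stdNormalPDF t := by
  have hn : (-1 : ℝ) < n := by linarith [n.cast_nonneg (α := ℝ)]
  convert (integrable_rpow_mul_exp_neg_mul_sq (b := 1 / 2) (by norm_num) hn).const_mul
    (Real.sqrt (2 * Real.pi))⁻¹ using 2 with t
  rw [Real.rpow_natCast, stdNormalPDF]
  ring_nf

theorem integrable_stdNormalPDF : Integrable stdNormalPDF := by
  simpa using integrable_pow_mul_stdNormalPDF 0

theorem integrable_mul_stdNormalPDF : Integrable fun t : ℝ => t * stdNormalPDF t := by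
  simpa using integrable_pow_mul_stdNormalPDF 1

theorem setIntegral_Iic_eq_of_hasDerivAt_of_integrable {f f' : ℝ → ℝ}
    (hderiv : ∀ t, HasDerivAt f (f' t) t) (hf' : Integrable f') (hf : Integrable f) (x : ℝ) :
    ∫ t in Set.Iic x, f' t = f x := by
  have hlim := tendsto_zero_of_hasDerivAt_of_integrableOn_Iic (a := x)
    (fun t _ => hderiv t) hf'.integrableOn hf.integrableOn
  simpa using integral_Iic_of_hasDerivAt_of_tendsto' (fun t _ => hderiv t) hf'.integrableOn hlim

theorem setIntegral_mul_stdNormalPDF (x : ℝ) :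
    ∫ t in Set.Iic x, t * stdNormalPDF t = -stdNormalPDF x :=
  setIntegral_Iic_eq_of_hasDerivAt_of_integrable
    (fun t => by simpa using (hasDerivAt_stdNormalPDF t).fun_neg)
    integrable_mul_stdNormalPDF integrable_stdNormalPDF.fun_neg x

theorem setIntegral_sq_mul_stdNormalPDF (x : ℝ) :
    ∫ t in Set.Iic x, t ^ 2 * stdNormalPDF t = stdNormalCDF x - x * stdNormalPDF x := by
  have h := setIntegral_Iic_eq_of_hasDerivAt_of_integrable
    (f' := fun t => stdNormalPDF t - t ^ 2 * stdNormalPDF t)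
    (fun t => ((hasDerivAt_id' t).fun_mul (hasDerivAt_stdNormalPDF t)).congr_deriv (by ring))
    (integrable_stdNormalPDF.sub (integrable_pow_mul_stdNormalPDF 2))
    integrable_mul_stdNormalPDF x
  rw [integral_sub integrable_stdNormalPDF.integrableOn
    (integrable_pow_mul_stdNormalPDF 2).integrableOn, ← stdNormalCDF] at h
  linarith

theorem setIntegral_Iic_pos {f : ℝ → ℝ} {x a : ℝ} (hf : IntegrableOn f (Set.Iic x))
    (hnonneg : ∀ t ≤ x, 0 ≤ f t) (hpos : ∀ t < a, 0 < f t) :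
    0 < ∫ t in Set.Iic x, f t := by
  rw [setIntegral_pos_iff_support_of_nonneg_ae
    ((ae_restrict_iff' measurableSet_Iic).2 (ae_of_all _ hnonneg)) hf]
  have hsub : Set.Iio (min a x) ⊆ Function.support f ∩ Set.Iic x := fun t ht =>
    ⟨(hpos t (lt_min_iff.1 ht).1).ne', Set.mem_Iic.2 (lt_min_iff.1 ht).2.le⟩
  exact lt_of_lt_of_le (by simp) (measure_mono hsub)

theorem stdNormalCDF_pos (x : ℝ) : 0 < stdNormalCDF x :=
  setIntegral_Iic_pos (a := x) integrable_stdNormalPDF.integrableOn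
    (fun t _ => (stdNormalPDF_pos t).le) fun t _ => stdNormalPDF_pos t

theorem mul_stdNormalCDF_add_stdNormalPDF_pos (x : ℝ) :
    0 < x * stdNormalCDF x + stdNormalPDF x := by
  have hint := (integrable_stdNormalPDF.const_mul x).sub integrable_mul_stdNormalPDF
  have h : 0 < ∫ t in Set.Iic x, (x * stdNormalPDF t - t * stdNormalPDF t) :=
    setIntegral_Iic_pos (a := x) hint.integrableOn
      (fun t ht => by nlinarith [stdNormalPDF_pos t])
      fun t ht => by nlinarith [stdNormalPDF_pos t]
  rw [integral_sub (integrable_stdNormalPDF.const_mul x).integrableOn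
    integrable_mul_stdNormalPDF.integrableOn, integral_const_mul, setIntegral_mul_stdNormalPDF,
    ← stdNormalCDF] at h
  linarith

/-- The second moment about `c` of the normal law restricted to `(-∞, x]` is positive. -/
theorem truncated_second_moment_pos (x c : ℝ) :
    0 < (1 + c ^ 2) * stdNormalCDF x - (x - 2 * c) * stdNormalPDF x := by
  have h₂ := integrable_pow_mul_stdNormalPDF 2
  have h₁ := integrable_mul_stdNormalPDF.const_mul (2 * c)
  have h₀ := integrable_stdNormalPDF.const_mul (c ^ 2)
  have h₂₁ : Integrable fun t => t ^ 2 * stdNormalPDF t - 2 * c * (t * stdNormalPDF t) :=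
    h₂.sub h₁
  have h : 0 < ∫ t in Set.Iic x,
      (t ^ 2 * stdNormalPDF t - 2 * c * (t * stdNormalPDF t) + c ^ 2 * stdNormalPDF t) := by
    have hsq (t : ℝ) : t ^ 2 * stdNormalPDF t - 2 * c * (t * stdNormalPDF t) +
        c ^ 2 * stdNormalPDF t = (t - c) ^ 2 * stdNormalPDF t := by ring
    refine setIntegral_Iic_pos (a := c) (h₂₁.add h₀).integrableOn ?_ ?_
    · intro t _
      rw [hsq]
      exact mul_nonneg (sq_nonneg _) (stdNormalPDF_pos t).le
    · intro t ht
      rw [hsq]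
      exact mul_pos (sq_pos_of_neg (sub_neg.2 ht)) (stdNormalPDF_pos t)
  rw [integral_add h₂₁.integrableOn h₀.integrableOn,
    integral_sub h₂.integrableOn h₁.integrableOn, integral_const_mul, integral_const_mul,
    setIntegral_mul_stdNormalPDF, setIntegral_sq_mul_stdNormalPDF, ← stdNormalCDF] at h
  linarith

/-- For every real `x`, `0 < λ(x)·(x + λ(x)) < 1`; equivalently
`0 < φ(x)·(x·Φ(x) + φ(x)) < Φ(x)²`. -/
theorem invMills_deriv_bounds (x : ℝ) :
    (0 < invMills x * (x + invMills x) ∧ invMills x * (x + invMills x) < 1) ∧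
      (0 < stdNormalPDF x * (x * stdNormalCDF x + stdNormalPDF x) ∧
        stdNormalPDF x * (x * stdNormalCDF x + stdNormalPDF x) < stdNormalCDF x ^ 2) := by
  have hΦ := stdNormalCDF_pos x
  have hlower : 0 < stdNormalPDF x * (x * stdNormalCDF x + stdNormalPDF x) :=
    mul_pos (stdNormalPDF_pos x) (mul_stdNormalCDF_add_stdNormalPDF_pos x)
  have hupper : stdNormalPDF x * (x * stdNormalCDF x + stdNormalPDF x) < stdNormalCDF x ^ 2 := by
    -- The optimal centre is the mean `-λ(x)` of the truncated law.
    have h := mul_pos hΦ (truncated_second_moment_pos x (-(stdNormalPDF x / stdNormalCDF x)))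
    have heq : stdNormalCDF x * ((1 + (-(stdNormalPDF x / stdNormalCDF x)) ^ 2) * stdNormalCDF x -
        (x - 2 * -(stdNormalPDF x / stdNormalCDF x)) * stdNormalPDF x) =
        stdNormalCDF x ^ 2 - stdNormalPDF x * (x * stdNormalCDF x + stdNormalPDF x) := by
      field_simp
      ring
    linarith
  have hratio : invMills x * (x + invMills x) =
      stdNormalPDF x * (x * stdNormalCDF x + stdNormalPDF x) / stdNormalCDF x ^ 2 := by
    unfold invMills
    field_simp
  rw [hratio, div_lt_one (pow_pos hΦ 2)]
  exact ⟨⟨div_pos hlower (pow_pos hΦ 2), hupper⟩, hlower, hupper⟩
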